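/- Let (M,d) be a nonempty compact metric space, τ_1,…,τ_N : M → M strict contractions, p_1,…,p_N > 0 with ∑_{i=1}^N p_i = 1, and let ℙ be the infinite product probability measure on Ω_N = {1,…,N}^ℕ whose every factor assigns mass p_i to the letter i. Let Y : Ω_N → M be the coding map determined by {Y(ω)} = ⋂_k τ_{ω|_k}(M). Then the pushforward measure μ = ℙ ∘ Y^{-1} is a Borel probability measure on M satisfying the self-similarity identity μ = ∑_{i=1}^N p_i (μ ∘ τ_i^{-1}), i.e., μ(B) = ∑_{i=1}^N p_i μ(τ_i^{-1}(B)) for every Borel set B ⊆ M; equivalently ∫_M f dμ = ∑_{i=1}^N p_i ∫_M (f∘τ_i) dμ for every bounded Borel function f. Moreover μ is the unique Borel probability measure on M satisfying this identity. -/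

import Mathlib

open Filter Topology MeasureTheory

/-- `τ_f = τ_{i₁} ∘ τ_{i₂} ∘ ⋯ ∘ τ_{i_k}` for a finite word `f = (i₁,…,i_k)`. -/
def wordMap {M : Type*} {N : ℕ} (τ : Fin N → M → M) : List (Fin N) → M → M
  | [] => id
  | i :: f => τ i ∘ wordMap τ f

/-- The cylinder set `E_f = {ω : ω_j = f_j for j < |f|}` of a finite word `f`. -/
def cylinder {N : ℕ} (f : List (Fin N)) : Set (ℕ → Fin N) :=
  {ω | ∀ j : Fin f.length, ω j = f.get j}

/-- Prepend a letter to an infinite word. -/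
def consWord {N : ℕ} (i : Fin N) (ω : ℕ → Fin N) : ℕ → Fin N
  | 0 => i
  | n + 1 => ω n

lemma measurable_consWord {N : ℕ} (i : Fin N) : Measurable (consWord i) := by
  rw [measurable_pi_iff]
  intro n
  cases n with
  | zero => exact measurable_const
  | succ n => exact measurable_pi_apply n

lemma mem_cylinder_cons {N : ℕ} (i : Fin N) (f : List (Fin N)) (ω : ℕ → Fin N) :
    ω ∈ cylinder (i :: f) ↔ ω 0 = i ∧ (fun n => ω (n + 1)) ∈ cylinder f := by
  constructor
  · intro h
    refine ⟨h ⟨0, by simp⟩, fun j => ?_⟩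
    exact h ⟨j.1 + 1, by simp⟩
  · rintro ⟨h0, h1⟩ ⟨j, hj⟩
    cases j with
    | zero => exact h0
    | succ j => exact h1 ⟨j, by simpa using hj⟩

lemma mem_cylinder_iff {N : ℕ} (f : List (Fin N)) (ω : ℕ → Fin N) :
    ω ∈ cylinder f ↔ ∀ j (h : j < f.length), ω j = f[j] :=
  ⟨fun h j hj => h ⟨j, hj⟩, fun h j => h j.1 j.2⟩

lemma measurableSet_cylinderWord {N : ℕ} (f : List (Fin N)) : MeasurableSet (cylinder f) := by
  have : cylinder f = ⋂ j : Fin f.length, (fun ω : ℕ → Fin N => ω j) ⁻¹' {f.get j} := by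
    ext ω; simp [_root_.cylinder]
  rw [this]
  exact MeasurableSet.iInter fun j => measurable_pi_apply _ (measurableSet_singleton _)

lemma isPiSystem_cylinderWord {N : ℕ} :
    IsPiSystem (Set.range (cylinder : List (Fin N) → Set (ℕ → Fin N))) := by
  have key : ∀ f g : List (Fin N), f.length ≤ g.length →
      (cylinder f ∩ cylinder g).Nonempty → cylinder f ∩ cylinder g = cylinder g := by
    rintro f g h ⟨ω, hf, hg⟩
    apply Set.inter_eq_right.2
    intro ω' h'
    rw [mem_cylinder_iff] at *
    intro j hj
    rw [h' j (by omega), ← hg j (by omega), hf j hj]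
  rintro _ ⟨f, rfl⟩ _ ⟨g, rfl⟩ hne
  rcases le_total f.length g.length with h | h
  · exact ⟨g, (key f g h hne).symm⟩
  · rw [Set.inter_comm] at hne ⊢
    exact ⟨f, (key g f h hne).symm⟩

lemma generateFrom_cylinderWord {N : ℕ} :
    (MeasurableSpace.pi : MeasurableSpace (ℕ → Fin N)) =
      MeasurableSpace.generateFrom (Set.range cylinder) := by
  apply le_antisymm
  · refine iSup_le fun n => ?_
    rw [← measurable_iff_comap_le]
    refine @measurable_to_countable' _ _ _ _ (_) _ fun a => ?_
    have : (fun ω : ℕ → Fin N => ω n) ⁻¹' {a} =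
        ⋃ f ∈ {f : List (Fin N) | f.length = n + 1 ∧ f[n]? = some a}, cylinder f := by
      ext ω
      simp only [Set.mem_preimage, Set.mem_singleton_iff, Set.mem_iUnion, Set.mem_ofPred_eq,
        exists_prop, mem_cylinder_iff]
      constructor
      · intro h
        exact ⟨(List.range (n + 1)).map ω, by simp [h]⟩
      · rintro ⟨f, ⟨h1, h2⟩, h3⟩
        rw [List.getElem?_eq_getElem (by omega)] at h2
        rw [h3 n (by omega)]
        exact Option.some.inj h2
    rw [this]
    refine @MeasurableSet.biUnion _ _ (_) _ _ (Set.to_countable _) fun f _ => ?_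
    exact MeasurableSpace.measurableSet_generateFrom ⟨f, rfl⟩
  · apply MeasurableSpace.generateFrom_le
    rintro _ ⟨f, rfl⟩
    exact measurableSet_cylinderWord f

lemma P_self_similar {N : ℕ} (p : Fin N → ℝ) (hp : ∀ i, 0 < p i) (hpsum : ∑ i, p i = 1)
    (P : Measure (ℕ → Fin N)) (hP : IsProbabilityMeasure P)
    (hPcyl : ∀ f : List (Fin N),
      P (cylinder f) = (f.map fun i => ENNReal.ofReal (p i)).prod) :
    P = ∑ i, ENNReal.ofReal (p i) • P.map (consWord i) := by
  have hs : ∑ i, ENNReal.ofReal (p i) = 1 := by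
    rw [← ENNReal.ofReal_sum_of_nonneg fun i _ => (hp i).le, hpsum, ENNReal.ofReal_one]
  refine ext_of_generate_finite _ generateFrom_cylinderWord isPiSystem_cylinderWord ?_ ?_
  · rintro _ ⟨f, rfl⟩
    simp only [Measure.coe_finsetSum, Finset.sum_apply, Measure.smul_apply, smul_eq_mul]
    simp only [Measure.map_apply (measurable_consWord _) (measurableSet_cylinderWord f)]
    cases f with
    | nil =>
      have : cylinder ([] : List (Fin N)) = Set.univ := by ext; simp [mem_cylinder_iff]
      simp [this, hs]
    | cons j g =>
      rw [Finset.sum_eq_single j]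
      · have : consWord j ⁻¹' cylinder (j :: g) = cylinder g := by
          ext ω; simp [mem_cylinder_cons, consWord]
        rw [this, hPcyl, hPcyl]; simp
      · intro i _ hij
        have : consWord i ⁻¹' cylinder (j :: g) = ∅ := by
          ext ω; simp [mem_cylinder_cons, consWord, hij]
        simp [this]
      · simp
  · simp only [Measure.coe_finsetSum, Finset.sum_apply, Measure.smul_apply, smul_eq_mul]
    simp only [Measure.map_apply (measurable_consWord _) MeasurableSet.univ]
    simp [hs]

lemma Y_cons {M : Type*} {N : ℕ} (τ : Fin N → M → M) (Y : (ℕ → Fin N) → M)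
    (hY : ∀ ω : ℕ → Fin N,
      (⋂ k : ℕ, Set.range (wordMap τ ((List.range (k + 1)).map ω))) = {Y ω})
    (i : Fin N) (ω : ℕ → Fin N) : Y (consWord i ω) = τ i (Y ω) := by
  symm
  rw [← Set.mem_singleton_iff, ← hY, Set.mem_iInter]
  have h : Y ω ∈ (⋂ k : ℕ, Set.range (wordMap τ ((List.range (k + 1)).map ω))) := by
    rw [hY]; rfl
  rw [Set.mem_iInter] at h
  intro k
  have e : (List.range (k + 1)).map (consWord i ω) = i :: (List.range k).map ω := by
    rw [List.range_succ_eq_map]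
    simp [consWord, Function.comp_def]
  rw [e]
  cases k with
  | zero => exact ⟨Y ω, rfl⟩
  | succ k =>
    obtain ⟨x, hx⟩ := h k
    exact ⟨x, by rw [← hx]; rfl⟩

lemma integral_form {M : Type*} [MeasurableSpace M]
    {N : ℕ} (τ : Fin N → M → M) (hm : ∀ i, Measurable (τ i))
    (p : Fin N → ℝ) (hp : ∀ i, 0 < p i) (ν : Measure M) [IsProbabilityMeasure ν]
    (h : ∀ B : Set M, MeasurableSet B →
        ν B = ∑ i : Fin N, ENNReal.ofReal (p i) * ν (τ i ⁻¹' B))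
    (f : M → ℝ) (hf : Measurable f) (hb : ∃ C : ℝ, ∀ x, |f x| ≤ C) :
    ∫ x, f x ∂ν = ∑ i : Fin N, p i * ∫ x, f (τ i x) ∂ν := by
  obtain ⟨C, hC⟩ := hb
  have e : ν = ∑ i, ENNReal.ofReal (p i) • ν.map (τ i) := by
    ext B hB
    simp only [Measure.coe_finsetSum, Finset.sum_apply, Measure.smul_apply, smul_eq_mul]
    simp only [Measure.map_apply (hm _) hB]
    exact h B hB
  conv_lhs => rw [e]
  rw [integral_finsetSum_measure]
  · refine Finset.sum_congr rfl fun i _ => ?_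
    rw [integral_smul_measure, integral_map (hm i).aemeasurable hf.aestronglyMeasurable,
      ENNReal.toReal_ofReal (hp i).le, smul_eq_mul]
  · intro i _
    have : IsProbabilityMeasure (ν.map (τ i)) :=
      Measure.isProbabilityMeasure_map (hm i).aemeasurable
    exact (Integrable.of_bound hf.aestronglyMeasurable C
      (Eventually.of_forall hC)).smul_measure ENNReal.ofReal_ne_top

lemma unique_aux {M : Type*} [MetricSpace M] [CompactSpace M] [Nonempty M]
    [MeasurableSpace M] [BorelSpace M]
    {N : ℕ} (τ : Fin N → M → M) (c : NNReal) (hc : ∀ i, LipschitzWith c (τ i))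
    (p : Fin N → ℝ) (hp : ∀ i, 0 < p i) (hpsum : ∑ i, p i = 1)
    (μ ν : Measure M) [IsProbabilityMeasure μ] [IsProbabilityMeasure ν]
    (hμ : ∀ B : Set M, MeasurableSet B →
        μ B = ∑ i : Fin N, ENNReal.ofReal (p i) * μ (τ i ⁻¹' B))
    (hν : ∀ B : Set M, MeasurableSet B →
        ν B = ∑ i : Fin N, ENNReal.ofReal (p i) * ν (τ i ⁻¹' B))
    (D : ℝ) (hD : ∀ x y : M, dist x y ≤ D) (e : ℝ) (n : ℕ) :
    ∀ f : M → ℝ, Continuous f → (∀ x y, dist x y ≤ c ^ n * D → |f x - f y| ≤ e) →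
      |∫ x, f x ∂μ - ∫ x, f x ∂ν| ≤ 2 * e := by
  have hbd : ∀ f : M → ℝ, Continuous f → ∃ C : ℝ, ∀ x, |f x| ≤ C := by
    intro f hf
    obtain ⟨C, hC⟩ := isCompact_univ.exists_bound_of_continuousOn hf.continuousOn
    exact ⟨C, fun x => hC x trivial⟩
  induction n with
  | zero =>
    intro f hf h
    obtain ⟨x0⟩ := ‹Nonempty M›
    obtain ⟨C, hC⟩ := hbd f hf
    have key : ∀ (ρ : Measure M) [IsProbabilityMeasure ρ], |∫ x, f x ∂ρ - f x0| ≤ e := by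
      intro ρ _
      have hi : Integrable f ρ :=
        Integrable.of_bound hf.measurable.aestronglyMeasurable C (Eventually.of_forall hC)
      have h1 : ∫ x, (f x - f x0) ∂ρ = ∫ x, f x ∂ρ - f x0 := by
        rw [integral_sub hi (integrable_const _)]; simp
      rw [← h1, ← Real.norm_eq_abs]
      refine (norm_integral_le_of_norm_le_const (C := e) (Eventually.of_forall fun x => ?_)).trans
        (by simp)
      exact h x x0 (by simpa using hD x x0)
    have a := abs_le.1 (key μ)
    have b := abs_le.1 (key ν)
    rw [abs_le]
    constructor <;> linarith [a.1, a.2, b.1, b.2]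
  | succ n ih =>
    intro f hf h
    have hm : ∀ i, Measurable (τ i) := fun i => (hc i).continuous.measurable
    rw [integral_form τ hm p hp μ hμ f hf.measurable (hbd f hf),
      integral_form τ hm p hp ν hν f hf.measurable (hbd f hf), ← Finset.sum_sub_distrib]
    calc _ ≤ ∑ i, |p i * ∫ x, f (τ i x) ∂μ - p i * ∫ x, f (τ i x) ∂ν| :=
          Finset.abs_sum_le_sum_abs _ _
      _ ≤ ∑ i, p i * (2 * e) := by
          refine Finset.sum_le_sum fun i _ => ?_
          rw [← mul_sub, abs_mul, abs_of_pos (hp i)]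
          refine mul_le_mul_of_nonneg_left ?_ (hp i).le
          refine ih (fun x => f (τ i x)) (hf.comp (hc i).continuous) fun x y hxy => ?_
          refine h _ _ (((hc i).dist_le_mul x y).trans ?_)
          rw [pow_succ', mul_assoc]
          exact mul_le_mul_of_nonneg_left hxy c.2
      _ = 2 * e := by rw [← Finset.sum_mul, hpsum, one_mul]

lemma unique_measure {M : Type*} [MetricSpace M] [CompactSpace M] [Nonempty M]
    [MeasurableSpace M] [BorelSpace M]
    {N : ℕ} (τ : Fin N → M → M)
    (hτ : ∀ i, ∃ c : NNReal, c < 1 ∧ LipschitzWith c (τ i))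
    (p : Fin N → ℝ) (hp : ∀ i, 0 < p i) (hpsum : ∑ i, p i = 1)
    (μ ν : Measure M) [IsProbabilityMeasure μ] [IsProbabilityMeasure ν]
    (hμ : ∀ B : Set M, MeasurableSet B →
        μ B = ∑ i : Fin N, ENNReal.ofReal (p i) * μ (τ i ⁻¹' B))
    (hν : ∀ B : Set M, MeasurableSet B →
        ν B = ∑ i : Fin N, ENNReal.ofReal (p i) * ν (τ i ⁻¹' B)) : μ = ν := by
  choose c' hc' hL using hτ
  let c : NNReal := Finset.univ.sup c'
  have hc1 : c < 1 := (Finset.sup_lt_iff (by simp)).2 fun i _ => hc' i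
  have hc : ∀ i, LipschitzWith c (τ i) := fun i =>
    (hL i).weaken (Finset.le_sup (f := c') (Finset.mem_univ i))
  have hD : ∀ x y : M, dist x y ≤ Metric.diam (Set.univ : Set M) := fun x y =>
    Metric.dist_le_diam_of_mem isCompact_univ.isBounded trivial trivial
  refine ext_of_forall_integral_eq_of_IsFiniteMeasure fun f => ?_
  rw [← sub_eq_zero, ← abs_nonpos_iff]
  refine le_of_forall_pos_le_add fun e he => ?_
  obtain ⟨δ, hδ, hf⟩ := Metric.uniformContinuous_iff.1
    (CompactSpace.uniformContinuous_of_continuous f.continuous) (e / 2) (by positivity)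
  have ht : Tendsto (fun n : ℕ => (c : ℝ) ^ n * Metric.diam (Set.univ : Set M)) atTop (𝓝 0) := by
    simpa using (tendsto_pow_atTop_nhds_zero_of_lt_one c.2
      (by exact_mod_cast hc1)).mul_const (Metric.diam (Set.univ : Set M))
  obtain ⟨n, hn⟩ := (ht.eventually (gt_mem_nhds hδ)).exists
  have := unique_aux τ c hc p hp hpsum μ ν hμ hν _ hD (e / 2) n f f.continuous
    fun x y hxy => (hf (hxy.trans_lt hn)).le
  linarith

/-- Let `τ₁,…,τ_N` be strict contractions of a nonempty compact metric space `M`,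
`p₁,…,p_N > 0` with `∑ pᵢ = 1`, `ℙ` the infinite product measure on `Ω_N` with factor
weights `pᵢ`, and `Y` the coding map.  Then `μ = ℙ ∘ Y⁻¹` is a Borel probability
measure satisfying `μ = ∑ᵢ pᵢ (μ ∘ τᵢ⁻¹)` (also in integral form), and it is the
unique Borel probability measure with this property. -/
theorem ifs_measure_self_similar_unique
    {M : Type*} [MetricSpace M] [CompactSpace M] [Nonempty M]
    [MeasurableSpace M] [BorelSpace M]
    (N : ℕ) (hN : 2 ≤ N) (τ : Fin N → M → M)
    (hτ : ∀ i, ∃ c : NNReal, c < 1 ∧ LipschitzWith c (τ i))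
    (p : Fin N → ℝ) (hp : ∀ i, 0 < p i) (hpsum : ∑ i, p i = 1)
    (P : Measure (ℕ → Fin N)) (hP : IsProbabilityMeasure P)
    (hPcyl : ∀ f : List (Fin N),
      P (cylinder f) = (f.map fun i => ENNReal.ofReal (p i)).prod)
    (Y : (ℕ → Fin N) → M) (hYcont : Continuous Y)
    (hY : ∀ ω : ℕ → Fin N,
      (⋂ k : ℕ, Set.range (wordMap τ ((List.range (k + 1)).map ω))) = {Y ω}) :
    IsProbabilityMeasure (P.map Y) ∧
    (∀ B : Set M, MeasurableSet B →
      (P.map Y) B = ∑ i : Fin N, ENNReal.ofReal (p i) * (P.map Y) (τ i ⁻¹' B)) ∧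
    (∀ f : M → ℝ, Measurable f → (∃ C : ℝ, ∀ x, |f x| ≤ C) →
      ∫ x, f x ∂(P.map Y) = ∑ i : Fin N, p i * ∫ x, f (τ i x) ∂(P.map Y)) ∧
    (∀ ν : Measure M, IsProbabilityMeasure ν →
      (∀ B : Set M, MeasurableSet B →
        ν B = ∑ i : Fin N, ENNReal.ofReal (p i) * ν (τ i ⁻¹' B)) →
      ν = P.map Y) := by
  have hm : ∀ i, Measurable (τ i) := fun i => by
    obtain ⟨c, _, h⟩ := hτ i
    exact h.continuous.measurable
  have hYm : Measurable Y := hYcont.measurable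
  have h1 : IsProbabilityMeasure (P.map Y) := Measure.isProbabilityMeasure_map hYm.aemeasurable
  have h2 : ∀ B : Set M, MeasurableSet B →
      (P.map Y) B = ∑ i : Fin N, ENNReal.ofReal (p i) * (P.map Y) (τ i ⁻¹' B) := by
    intro B hB
    rw [Measure.map_apply hYm hB]
    conv_lhs => rw [P_self_similar p hp hpsum P hP hPcyl]
    simp only [Measure.coe_finsetSum, Finset.sum_apply, Measure.smul_apply, smul_eq_mul]
    refine Finset.sum_congr rfl fun i _ => ?_
    rw [Measure.map_apply (measurable_consWord i) (hYm hB), Measure.map_apply hYm (hm i hB)]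
    congr 2
    ext ω
    simp [Y_cons τ Y hY]
  refine ⟨h1, h2, fun f hf hb => integral_form τ hm p hp _ h2 f hf hb, ?_⟩
  intro ν hν h
  exact unique_measure τ hτ p hp hpsum ν _ h h2
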